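/- arXiv:2206.02414 — 3 statements merged into one kernel-verified Lean document; each statement's English description precedes it below -/
import Mathlib

section
/- For every half-space H ⊆ ℝ², the set {n mod Γ₀ : n ∈ H ∩ ℤ²} of projections of the integer points of H is dense in the torus T = ℝ²/Γ₀. -/
/-!
Statement 5: For every half-space H ⊆ ℝ², the set {n mod Γ₀ : n ∈ H ∩ ℤ²} of projections of
the integer points of H is dense in the torus T = ℝ²/Γ₀, where Γ₀ is the lattice generated
by (φ,0) and (1,φ+3) and a half-space is any translate of {x ∈ ℝ² : x·v ≤ 0} for a unit
vector v (equivalently, {x ∈ ℝ² : x·v ≤ c} for v ≠ 0 and c ∈ ℝ).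
-/

noncomputable section

namespace JeandelRao

/-- The golden ratio. -/
def φ : ℝ := (1 + Real.sqrt 5) / 2

/-- The lattice Γ₀ generated by (φ,0) and (1,φ+3). -/
def Γ₀ : AddSubgroup (ℝ × ℝ) := AddSubgroup.closure {(φ, 0), (1, φ + 3)}

/-- The torus T = ℝ²/Γ₀. -/
abbrev T : Type := (ℝ × ℝ) ⧸ Γ₀

/-- The canonical projection ℝ² → ℝ²/Γ₀. -/
def π : ℝ × ℝ → T := QuotientAddGroup.mk

/-- The canonical embedding of ℤ² into ℝ². -/
def ι (n : ℤ × ℤ) : ℝ × ℝ := ((n.1 : ℝ), (n.2 : ℝ))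

theorem exists_int_sub_mul_mem_Ioo {α : ℝ} (hα : Irrational α) {a b : ℝ} (hab : a < b) :
    ∃ n k : ℤ, (n : ℝ) - k * α ∈ Set.Ioo a b := by
  have hd : Dense (AddSubgroup.closure {1, α} : Set ℝ) :=
    dense_addSubgroupClosure_pair_iff.2 (by simpa using hα.inv)
  obtain ⟨x, hx, hxab⟩ := hd.exists_mem_open isOpen_Ioo (Set.nonempty_Ioo.2 hab)
  obtain ⟨n, k, rfl⟩ := AddSubgroup.mem_closure_pair.1 hx
  exact ⟨n, -k, by simpa using hxab⟩

/-- Integer combinations `n - k * α` stay dense when `n` is restricted to large values. -/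
theorem exists_int_ge_abs_sub_mul_sub_lt {α : ℝ} (hα : Irrational α) (y : ℝ) {ε : ℝ}
    (hε : 0 < ε) (M : ℤ) : ∃ n k : ℤ, M ≤ n ∧ |(n : ℝ) - k * α - y| < ε := by
  obtain ⟨n, k, h₁, h₂⟩ := exists_int_sub_mul_mem_Ioo hα (show y - ε / 2 < y + ε / 2 by linarith)
  set t : ℤ := |M - n| + 1
  have ht : 0 < t := by positivity
  have htM : M - n < t := by have := le_abs_self (M - n); omega
  have htR : (0 : ℝ) < t := by exact_mod_cast ht
  obtain ⟨p, q, h₃, h₄⟩ := exists_int_sub_mul_mem_Ioo hα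
    (show (0 : ℝ) < min (ε / 2 / t) |α| from lt_min (by positivity) (abs_pos.2 hα.ne_zero))
  obtain ⟨h₄, h₅⟩ := lt_min_iff.1 h₄
  rw [lt_div_iff₀ htR] at h₄
  have hp : p ≠ 0 := by
    rintro rfl
    rw [← abs_of_pos h₃, Int.cast_zero, zero_sub, abs_neg, abs_mul,
      mul_lt_iff_lt_one_left (abs_pos.2 hα.ne_zero), ← Int.cast_abs] at h₅
    have hq : q = 0 := Int.abs_lt_one_iff.1 (by exact_mod_cast h₅)
    simp [hq] at h₃
  have hpos := mul_pos h₃ htR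
  rcases lt_or_gt_of_ne hp with hp | hp
  · refine ⟨n - t * p, k - t * q, by nlinarith, ?_⟩
    push_cast
    rw [abs_lt]
    constructor <;> linarith
  · refine ⟨n + t * p, k + t * q, by nlinarith, ?_⟩
    push_cast
    rw [abs_lt]
    constructor <;> linarith

theorem exists_int_mul_le_abs_sub_mul_sub_lt {α : ℝ} (hα : Irrational α) (y : ℝ) {ε : ℝ}
    (hε : 0 < ε) {w : ℝ} (hw : w ≠ 0) (c : ℝ) :
    ∃ n k : ℤ, (n : ℝ) * w ≤ c ∧ |(n : ℝ) - k * α - y| < ε := by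
  rcases lt_or_gt_of_ne hw with hw | hw
  · obtain ⟨n, k, hn, h⟩ := exists_int_ge_abs_sub_mul_sub_lt hα y hε ⌈c / w⌉
    exact ⟨n, k, (div_le_iff_of_neg hw).1 (Int.ceil_le.1 hn), h⟩
  · obtain ⟨n, k, hn, h⟩ := exists_int_ge_abs_sub_mul_sub_lt hα (-y) hε (-⌊c / w⌋)
    refine ⟨-n, -k, (le_div_iff₀ hw).1 (Int.le_floor.1 (by omega)), ?_⟩
    rw [← abs_neg] at h
    convert h using 2
    push_cast
    ring

theorem irrational_φ : Irrational φ := Real.goldenRatio_irrational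

theorem π_sub_eq (x : ℝ × ℝ) (j k : ℤ) :
    π (x.1 - k - j * φ, x.2 - k * (φ + 3)) = π x := by
  refine QuotientAddGroup.eq.2 (AddSubgroup.mem_closure_pair.2 ⟨j, k, ?_⟩)
  ext <;> simp <;> ring

theorem halfspace_integer_points_dense (v : ℝ × ℝ) (hv : v ≠ 0) (c : ℝ) :
    Dense {t : T | ∃ n : ℤ × ℤ,
      (n.1 : ℝ) * v.1 + (n.2 : ℝ) * v.2 ≤ c ∧ t = π (ι n)} := by
  have hφ := irrational_φ
  have hφ3 : Irrational (φ + 3) := by exact_mod_cast hφ.add_natCast 3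
  have approx : ∀ (x y ε : ℝ), 0 < ε → ∃ m n j k : ℤ, (m : ℝ) * v.1 + n * v.2 ≤ c ∧
      |(m : ℝ) - k - j * φ - x| < ε ∧ |(n : ℝ) - k * (φ + 3) - y| < ε := by
    intro x y ε hε
    by_cases h₁ : v.1 = 0
    · have h₂ : v.2 ≠ 0 := fun h₂ => hv (Prod.ext h₁ h₂)
      obtain ⟨n, k, hn, h⟩ := exists_int_mul_le_abs_sub_mul_sub_lt hφ3 y hε h₂ c
      obtain ⟨m, j, -, h'⟩ := exists_int_ge_abs_sub_mul_sub_lt hφ (x + k) hε 0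
      refine ⟨m, n, j, k, by simpa [h₁] using hn, ?_, h⟩
      convert h' using 2
      ring
    · obtain ⟨n, k, -, h⟩ := exists_int_ge_abs_sub_mul_sub_lt hφ3 y hε 0
      obtain ⟨m, j, hm, h'⟩ :=
        exists_int_mul_le_abs_sub_mul_sub_lt hφ (x + k) hε h₁ (c - n * v.2)
      refine ⟨m, n, j, k, by linarith, ?_, h⟩
      convert h' using 2
      ring
  have hdense : Dense (π ⁻¹' {t : T | ∃ n : ℤ × ℤ,
      (n.1 : ℝ) * v.1 + (n.2 : ℝ) * v.2 ≤ c ∧ t = π (ι n)}) := by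
    refine Metric.dense_iff.2 fun p ε hε => ?_
    obtain ⟨m, n, j, k, hc, hx, hy⟩ := approx p.1 p.2 ε hε
    refine ⟨(m - k - j * φ, n - k * (φ + 3)), ?_, (m, n), hc, π_sub_eq (m, n) j k⟩
    exact Metric.mem_ball.2 (max_lt hx hy)
  have hsurj : Function.Surjective π := QuotientAddGroup.mk_surjective
  have hcont : Continuous π := continuous_quotient_mk'
  exact (hsurj.denseRange.dense_image hcont hdense).mono (Set.image_preimage_subset _ _)

end JeandelRao
end
end

section
/- Let P₁ be a point of ℝ² lying on (a lift of) a Δ-line ℓ₁ and P₂ a point of ℝ² lying on (a lift of) a Δ-line ℓ₂, with P₁ − P₂ ∈ ℤ². If ℓ₁ is not parallel to ℓ₂, then P₁ and P₂ both lie in Γ₀ + ℤ². -/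
noncomputable section

namespace JeandelRao

/-- The ℤ²-rotation action R₀ⁿ(x) = x + n on the torus T. -/
def R₀ (n : ℤ × ℤ) (x : T) : T := x + π (ι n)

/-- The endpoints of the Δ-lines: the boundary Δ = ⋃ₐ ∂Pₐ of Labbé's polygonal partition
P₀ = {P₀,…,P₁₀} of T is the union of these closed line segments, each of slope
0, φ, φ² or ∞. -/
def ΔLines : List ((ℝ × ℝ) × (ℝ × ℝ)) :=
  [ -- slope 0
    ((0, 0), (φ, 0)), ((0, 1), (φ, 1)),
    -- slope φ
    ((0, 0), (φ - 1, 1)), ((1, 0), (φ, 1)),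
    ((0, 1), (φ - 1, 2)), ((φ - 1, 2), (2*φ - 2, 3)), ((2*φ - 2, 3), (φ, φ + 2)),
    ((1, 1), (φ, 2)),
    ((0, 2), (φ - 1, 3)), ((φ - 1, 3), (1, φ + 2)), ((1, φ + 2), (2*φ - 2, 4)),
    ((2*φ - 2, 4), (φ, φ + 3)),
    ((0, φ + 1), (2*φ - 3, 3)), ((2*φ - 3, 3), (φ - 1, φ + 2)),
    ((2 - φ, φ + 2), (φ - 1, 4)),
    -- slope φ²
    ((φ - 1, 0), (1, 1)),
    ((0, 1), (2 - φ, 2)), ((2 - φ, 2), (4 - 2*φ, 3)), ((4 - 2*φ, 3), (1, φ + 2)),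
    ((φ - 1, 1), (1, 2)), ((1, 2), (3 - φ, 3)), ((3 - φ, 3), (φ, φ + 2)),
    ((0, 2), (2 - φ, 3)), ((2 - φ, 3), (4 - 2*φ, 4)), ((4 - 2*φ, 4), (1, φ + 3)),
    ((0, φ + 2), (5 - 3*φ, 4)), ((5 - 3*φ, 4), (2 - φ, φ + 3)),
    -- slope ∞
    ((0, 0), (0, 1)), ((0, 1), (0, 2)), ((0, 2), (0, 3)), ((0, 3), (0, 4)),
    ((0, 4), (0, φ + 3)),
    ((2 - φ, φ + 2), (2 - φ, 4)), ((2 - φ, 4), (2 - φ, φ + 3)),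
    ((φ - 1, 0), (φ - 1, 1)), ((φ - 1, 1), (φ - 1, 2)),
    ((1, 0), (1, 1)), ((1, 1), (1, 2)),
    ((1, φ + 1), (1, 3)), ((1, 3), (1, 4)), ((1, 4), (1, φ + 3)) ]

/-- The boundary Δ ⊆ ℝ² of the partition P₀ (as a subset of a fundamental domain of T),
i.e. the union of the Δ-lines. -/
def Δ : Set (ℝ × ℝ) := {x | ∃ pq ∈ ΔLines, x ∈ segment ℝ pq.1 pq.2}


/-- The subgroup Γ₀ + ℤ² of ℝ². -/
def ΓplusZ2 : Set (ℝ × ℝ) := {x | ∃ g ∈ Γ₀, ∃ n : ℤ × ℤ, x = g + ι n}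

lemma φ_sq : φ ^ 2 = φ + 1 := Real.goldenRatio_sq

/-- The ring ℤ[φ] of integers of ℚ(√5). -/
def goldenIntegers : Subring ℝ where
  carrier := {x | ∃ a b : ℤ, x = a + b * φ}
  zero_mem' := ⟨0, 0, by simp⟩
  one_mem' := ⟨1, 0, by simp⟩
  add_mem' := by
    rintro _ _ ⟨a, b, rfl⟩ ⟨c, d, rfl⟩
    exact ⟨a + c, b + d, by push_cast; ring⟩
  neg_mem' := by
    rintro _ ⟨a, b, rfl⟩
    exact ⟨-a, -b, by push_cast; ring⟩
  mul_mem' := by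
    rintro _ _ ⟨a, b, rfl⟩ ⟨c, d, rfl⟩
    exact ⟨a * c + b * d, a * d + b * c + b * d, by
      push_cast; linear_combination (b * d : ℝ) * φ_sq⟩

lemma φ_mem_goldenIntegers : φ ∈ goldenIntegers := ⟨0, 1, by simp⟩

/-- Γ₀ + ℤ² contains ℤ[φ]². -/
lemma mem_ΓplusZ2 {P : ℝ × ℝ} (h₁ : P.1 ∈ goldenIntegers) (h₂ : P.2 ∈ goldenIntegers) :
    P ∈ ΓplusZ2 := by
  obtain ⟨a, b, hab⟩ := h₁
  obtain ⟨c, d, hcd⟩ := h₂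
  refine ⟨b • (φ, 0) + d • (1, φ + 3), ?_, (a - d, c - 3 * d), ?_⟩
  · exact add_mem (zsmul_mem (AddSubgroup.subset_closure (by simp)) b)
      (zsmul_mem (AddSubgroup.subset_closure (by simp)) d)
  · ext
    · simp [ι, hab]; ring
    · simp [ι, hcd]; ring

lemma mem_goldenIntegers_of_mem_Γ₀ {g : ℝ × ℝ} (hg : g ∈ Γ₀) :
    g.1 ∈ goldenIntegers ∧ g.2 ∈ goldenIntegers := by
  have hle : Γ₀ ≤ goldenIntegers.toAddSubgroup.prod goldenIntegers.toAddSubgroup := by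
    refine (AddSubgroup.closure_le _).2 ?_
    rintro _ (rfl | rfl) <;>
      simp [AddSubgroup.mem_prod, φ_mem_goldenIntegers, add_mem, one_mem, zero_mem]
  exact AddSubgroup.mem_prod.1 (hle hg)

/-- Normal vectors to the four slopes 0, φ, φ² = φ + 1 and ∞ of the Δ-lines. -/
def normals : List (ℝ × ℝ) := [(0, 1), (φ, -1), (φ + 1, -1), (1, 0)]

lemma normals_mem_goldenIntegers {n : ℝ × ℝ} (hn : n ∈ normals) :
    n.1 ∈ goldenIntegers ∧ n.2 ∈ goldenIntegers := by
  simp only [normals, List.mem_cons, List.not_mem_nil, or_false] at hn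
  rcases hn with rfl | rfl | rfl | rfl <;>
    simp [φ_mem_goldenIntegers, add_mem, one_mem, zero_mem]

/-- Two distinct normals have a determinant which is a unit of ℤ[φ]. -/
lemma exists_inv_det_normals {m n : ℝ × ℝ} (hm : m ∈ normals) (hn : n ∈ normals) (hne : m ≠ n) :
    ∃ e ∈ goldenIntegers, e * (m.1 * n.2 - m.2 * n.1) = 1 := by
  have hφ := φ_mem_goldenIntegers
  have key : ∀ e c d : ℝ, e ∈ goldenIntegers → e * c = 1 → (d = c ∨ d = -c) →
      ∃ e ∈ goldenIntegers, e * d = 1 := by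
    rintro e c d he h (rfl | rfl)
    exacts [⟨e, he, h⟩, ⟨-e, neg_mem he, by rw [neg_mul_neg, h]⟩]
  have key_one := fun d ↦ key 1 1 d (one_mem _) (one_mul 1)
  have key_φ := fun d ↦ key (φ - 1) φ d (sub_mem hφ (one_mem _)) (by linear_combination φ_sq)
  have key_φ_add_one := fun d ↦ key (2 - φ) (φ + 1) d (sub_mem (ofNat_mem _ 2) hφ)
    (by linear_combination -φ_sq)
  simp only [normals, List.mem_cons, List.not_mem_nil, or_false] at hm hn
  rcases hm with rfl | rfl | rfl | rfl <;> rcases hn with rfl | rfl | rfl | rfl <;>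
    first
    | (simp only [ne_eq, not_true_eq_false] at hne; done)
    | exact key_one _ (by first | (left; ring1) | (right; ring1))
    | exact key_φ _ (by first | (left; ring1) | (right; ring1))
    | exact key_φ_add_one _ (by first | (left; ring1) | (right; ring1))

/-- A Δ-line starts at a point of ℤ[φ]² and is orthogonal to one of the four normals. -/
lemma ΔLines_spec : ∀ pq ∈ ΔLines, (pq.1.1 ∈ goldenIntegers ∧ pq.1.2 ∈ goldenIntegers) ∧
    ∃ n ∈ normals, n.1 * (pq.2.1 - pq.1.1) + n.2 * (pq.2.2 - pq.1.2) = 0 := by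
  have hsq := φ_sq
  have hφ := φ_mem_goldenIntegers
  simp only [ΔLines, List.forall_mem_cons, List.not_mem_nil, false_imp_iff, implies_true,
    and_true]
  repeat' apply And.intro
  any_goals simp [normals, hφ, add_mem, sub_mem, mul_mem, one_mem, zero_mem, ofNat_mem]; done
  all_goals
    simp only [normals, List.exists_mem_cons_iff]
    grind

/-- On a lift of a Δ-line, the linear form given by a normal takes a constant value, which lies
in ℤ[φ]. -/
lemma linear_form_mem {p q P n : ℝ × ℝ} (hp : p.1 ∈ goldenIntegers ∧ p.2 ∈ goldenIntegers)
    (hn : n ∈ normals) (horth : n.1 * (q.1 - p.1) + n.2 * (q.2 - p.2) = 0)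
    (hP : ∃ g ∈ Γ₀, P - g ∈ segment ℝ p q) :
    n.1 * P.1 + n.2 * P.2 ∈ goldenIntegers := by
  obtain ⟨g, hg, hseg⟩ := hP
  rw [segment_eq_image'] at hseg
  obtain ⟨t, -, ht⟩ := hseg
  have hx : p.1 + t * (q.1 - p.1) = P.1 - g.1 := congrArg Prod.fst ht
  have hy : p.2 + t * (q.2 - p.2) = P.2 - g.2 := congrArg Prod.snd ht
  have heq : n.1 * P.1 + n.2 * P.2 = n.1 * (p.1 + g.1) + n.2 * (p.2 + g.2) := by
    linear_combination t * horth - n.1 * hx - n.2 * hy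
  obtain ⟨hn₁, hn₂⟩ := normals_mem_goldenIntegers hn
  obtain ⟨hg₁, hg₂⟩ := mem_goldenIntegers_of_mem_Γ₀ hg
  rw [heq]
  exact add_mem (mul_mem hn₁ (add_mem hp.1 hg₁)) (mul_mem hn₂ (add_mem hp.2 hg₂))

/-- Two vectors orthogonal to a common normal are parallel. -/
lemma parallel_of_orthogonal {n : ℝ × ℝ} (hn : n ∈ normals) {a b c d : ℝ}
    (h₁ : n.1 * a + n.2 * b = 0) (h₂ : n.1 * c + n.2 * d = 0) : a * d = b * c := by
  simp only [normals, List.mem_cons, List.not_mem_nil, or_false] at hn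
  rcases hn with rfl | rfl | rfl | rfl <;> grind

/-- A point at which the linear forms of two distinct normals take values in ℤ[φ] has
coordinates in ℤ[φ]. -/
lemma mem_goldenIntegers_of_linear_forms {m n P : ℝ × ℝ} (hm : m ∈ normals) (hn : n ∈ normals)
    (hne : m ≠ n) (h₁ : m.1 * P.1 + m.2 * P.2 ∈ goldenIntegers)
    (h₂ : n.1 * P.1 + n.2 * P.2 ∈ goldenIntegers) :
    P.1 ∈ goldenIntegers ∧ P.2 ∈ goldenIntegers := by
  obtain ⟨e, he, hdet⟩ := exists_inv_det_normals hm hn hne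
  obtain ⟨hm₁, hm₂⟩ := normals_mem_goldenIntegers hm
  obtain ⟨hn₁, hn₂⟩ := normals_mem_goldenIntegers hn
  have hx : P.1 = e * ((m.1 * P.1 + m.2 * P.2) * n.2 - (n.1 * P.1 + n.2 * P.2) * m.2) := by
    linear_combination -P.1 * hdet
  have hy : P.2 = e * ((n.1 * P.1 + n.2 * P.2) * m.1 - (m.1 * P.1 + m.2 * P.2) * n.1) := by
    linear_combination -P.2 * hdet
  constructor
  · rw [hx]
    exact mul_mem he (sub_mem (mul_mem h₁ hn₂) (mul_mem h₂ hm₂))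
  · rw [hy]
    exact mul_mem he (sub_mem (mul_mem h₂ hm₁) (mul_mem h₁ hn₁))

/-- let P₁ be a point of ℝ² lying on a lift of a Δ-line ℓ₁ and P₂ a point of
ℝ² lying on a lift of a Δ-line ℓ₂, with P₁ − P₂ ∈ ℤ².  If ℓ₁ is not parallel to ℓ₂, then
P₁ and P₂ both lie in Γ₀ + ℤ². -/
theorem nonparallel_intersections_in_lattice
    (p₁ q₁ p₂ q₂ : ℝ × ℝ) (h₁ : (p₁, q₁) ∈ ΔLines) (h₂ : (p₂, q₂) ∈ ΔLines)
    (P₁ P₂ : ℝ × ℝ)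
    (hP₁ : ∃ g ∈ Γ₀, P₁ - g ∈ segment ℝ p₁ q₁)
    (hP₂ : ∃ g ∈ Γ₀, P₂ - g ∈ segment ℝ p₂ q₂)
    (hdiff : ∃ n : ℤ × ℤ, P₁ - P₂ = ι n)
    (hnotpar : (q₁.1 - p₁.1) * (q₂.2 - p₂.2) ≠ (q₁.2 - p₁.2) * (q₂.1 - p₂.1)) :
    P₁ ∈ ΓplusZ2 ∧ P₂ ∈ ΓplusZ2 := by
  obtain ⟨hp₁, m, hm, hmo⟩ := ΔLines_spec _ h₁
  obtain ⟨hp₂, n, hn, hno⟩ := ΔLines_spec _ h₂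
  have hne : m ≠ n := by
    rintro rfl
    exact hnotpar (parallel_of_orthogonal hm hmo hno)
  obtain ⟨k, hk⟩ := hdiff
  have hkx : P₁.1 - P₂.1 = k.1 := congrArg Prod.fst hk
  have hky : P₁.2 - P₂.2 = k.2 := congrArg Prod.snd hk
  obtain ⟨hn₁, hn₂⟩ := normals_mem_goldenIntegers hn
  have hform : n.1 * P₁.1 + n.2 * P₁.2 ∈ goldenIntegers := by
    have heq : n.1 * P₁.1 + n.2 * P₁.2 = n.1 * P₂.1 + n.2 * P₂.2 + (n.1 * k.1 + n.2 * k.2) := by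
      linear_combination n.1 * hkx + n.2 * hky
    rw [heq]
    exact add_mem (linear_form_mem hp₂ hn hno hP₂)
      (add_mem (mul_mem hn₁ (intCast_mem _ _)) (mul_mem hn₂ (intCast_mem _ _)))
  obtain ⟨hx, hy⟩ :=
    mem_goldenIntegers_of_linear_forms hm hn hne (linear_form_mem hp₁ hm hmo hP₁) hform
  refine ⟨mem_ΓplusZ2 hx hy, mem_ΓplusZ2 ?_ ?_⟩
  · rw [show P₂.1 = P₁.1 - k.1 by linear_combination -hkx]
    exact sub_mem hx (intCast_mem _ _)
  · rw [show P₂.2 = P₁.2 - k.2 by linear_combination -hky]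
    exact sub_mem hy (intCast_mem _ _)

end JeandelRao
end
end

section
/- Let ω = (φ, 0) and β ∈ [0,1]. Then the set {n ∈ ℤ² : there exist g ∈ Γ₀ and α ∈ [0,1] with βω + n = g + αω} is equal to ℤ × {0}. -/
/-!
Statement 12: Let ω = (φ, 0) and β ∈ [0,1], where φ = (1+√5)/2 and Γ₀ is the lattice in ℝ²
generated by (φ,0) and (1,φ+3).  Then the set
{n ∈ ℤ² : ∃ g ∈ Γ₀ and α ∈ [0,1] with βω + n = g + αω} is equal to ℤ × {0}.
-/

noncomputable section

namespace JeandelRao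

theorem φ_pos : 0 < φ := Real.goldenRatio_pos

theorem irrational_φ_add_three : Irrational (φ + 3) := by
  exact_mod_cast Real.goldenRatio_irrational.add_natCast 3

theorem mem_Γ₀ {g : ℝ × ℝ} :
    g ∈ Γ₀ ↔ ∃ a b : ℤ, g = ((a : ℝ) * φ + b, (b : ℝ) * (φ + 3)) := by
  simp only [Γ₀, AddSubgroup.mem_closure_pair, Prod.smul_mk, Prod.mk_add_mk, zsmul_eq_mul,
    mul_one, mul_zero, zero_add, eq_comm]

theorem eq_zero_of_intCast_eq_mul {n b : ℤ} (h : (n : ℝ) = b * (φ + 3)) : n = 0 := by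
  rcases eq_or_ne b 0 with rfl | hb
  · simpa using h
  · exact absurd h.symm ((irrational_φ_add_three.intCast_mul hb).ne_int n)

theorem slope_zero_case (β : ℝ) (hβ : β ∈ Set.Icc (0 : ℝ) 1) :
    {n : ℤ × ℤ | ∃ g ∈ Γ₀, ∃ α ∈ Set.Icc (0 : ℝ) 1,
        β • ((φ, 0) : ℝ × ℝ) + ((n.1 : ℝ), (n.2 : ℝ)) = g + α • ((φ, 0) : ℝ × ℝ)}
      = {n : ℤ × ℤ | n.2 = 0} := by
  ext ⟨m, n⟩
  simp only [Set.mem_ofPred_eq]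
  constructor
  · rintro ⟨g, hg, α, -, h⟩
    obtain ⟨a, b, rfl⟩ := mem_Γ₀.1 hg
    refine eq_zero_of_intCast_eq_mul (b := b) ?_
    simpa using congrArg Prod.snd h
  · rintro rfl
    refine ⟨_, mem_Γ₀.2 ⟨⌊β + m / φ⌋, 0, rfl⟩, Int.fract (β + m / φ),
      ⟨Int.fract_nonneg _, (Int.fract_lt_one _).le⟩, ?_⟩
    have key : β * φ + m = ⌊β + m / φ⌋ * φ + Int.fract (β + m / φ) * φ := by
      rw [← add_mul, Int.floor_add_fract, add_mul, div_mul_cancel₀ _ φ_pos.ne']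
    simpa using key

end JeandelRao
end
end
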